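/- For the distributed gradient-tracking algorithm (with each f_i differentiable), the consensus error satisfies, for every k ≥ 1: ‖x(k) − 𝟙x̄(k)‖ ≤ σ ‖x(k−1) − 𝟙x̄(k−1)‖ + η ‖s(k−1) − 𝟙g(k−1)‖. -/

import Mathlib

open scoped BigOperators RealInnerProductSpace
open Filter

noncomputable section

abbrev Vec (N : ℕ) := EuclideanSpace ℝ (Fin N)

/-- Frobenius norm of a stacked matrix in `ℝ^{n×N}`, viewed as `n` rows in `ℝ^N`. -/
def fro {n N : ℕ} (A : Fin n → Vec N) : ℝ := Real.sqrt (∑ i, ‖A i‖ ^ 2)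

/-- Spectral norm (largest singular value) of a square real matrix, as the operator norm
of the induced linear map between Euclidean spaces. -/
def specNorm {n : ℕ} (M : Matrix (Fin n) (Fin n) ℝ) : ℝ :=
  ‖LinearMap.toContinuousLinearMap (Matrix.toEuclideanLin M)‖

theorem fro_eq_norm {n N : ℕ} (A : Fin n → Vec N) :
    fro A = ‖(WithLp.toLp 2 A : PiLp 2 fun _ : Fin n => Vec N)‖ := by
  rw [PiLp.norm_eq_of_L2, fro]

theorem fro_sub_le {n N : ℕ} (A B : Fin n → Vec N) : fro (A - B) ≤ fro A + fro B := by
  simp only [fro_eq_norm, WithLp.toLp_sub]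
  exact norm_sub_le _ _

theorem fro_smul {n N : ℕ} (c : ℝ) (A : Fin n → Vec N) : fro (c • A) = |c| * fro A := by
  simp only [fro_eq_norm, WithLp.toLp_smul, norm_smul, Real.norm_eq_abs]

theorem sum_norm_sq_eq_sum_col {n N : ℕ} (A : Fin n → Vec N) :
    ∑ i, ‖A i‖ ^ 2 = ∑ c, ‖(WithLp.toLp 2 fun i => A i c : Vec n)‖ ^ 2 := by
  simp only [EuclideanSpace.norm_sq_eq]
  exact Finset.sum_comm

theorem norm_toEuclideanLin_le {n : ℕ} (M : Matrix (Fin n) (Fin n) ℝ) (v : Vec n) :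
    ‖Matrix.toEuclideanLin M v‖ ≤ specNorm M * ‖v‖ :=
  (LinearMap.toContinuousLinearMap (Matrix.toEuclideanLin M)).le_opNorm v

/-- Left multiplication by `M` is bounded in Frobenius norm by the spectral norm of `M`. -/
theorem fro_mul_le {n N : ℕ} (M : Matrix (Fin n) (Fin n) ℝ) (A : Fin n → Vec N) :
    fro (fun i => ∑ j, M i j • A j) ≤ specNorm M * fro A := by
  have hM : 0 ≤ specNorm M := norm_nonneg _
  rw [fro, fro, ← Real.sqrt_sq hM, ← Real.sqrt_mul (sq_nonneg _)]
  apply Real.sqrt_le_sqrt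
  rw [sum_norm_sq_eq_sum_col, sum_norm_sq_eq_sum_col A, Finset.mul_sum]
  refine Finset.sum_le_sum fun c _ => ?_
  have hcol : (WithLp.toLp 2 fun i => (∑ j, M i j • A j) c : Vec n) =
      Matrix.toEuclideanLin M (WithLp.toLp 2 fun i => A i c) := by
    ext i
    simp [Matrix.toLpLin_apply, Matrix.mulVec, dotProduct]
  rw [hcol, ← mul_pow]
  exact pow_le_pow_left₀ (norm_nonneg _) (norm_toEuclideanLin_le _ _) 2

/-- A matrix with unit column sums preserves the sum of the rows it acts on. -/
theorem sum_sum_smul_eq {n N : ℕ} {W : Matrix (Fin n) (Fin n) ℝ}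
    (hWcol : ∀ j, ∑ i, W i j = 1) (A : Fin n → Vec N) :
    ∑ i, ∑ j, W i j • A j = ∑ j, A j := by
  rw [Finset.sum_comm]
  simp only [← Finset.sum_smul, hWcol, one_smul]

/-- Removing the averaging matrix from a matrix with unit row sums gives the same action on
deviations from the mean. -/
theorem sum_sub_averaging_smul {n N : ℕ} (hn : 0 < n) {W : Matrix (Fin n) (Fin n) ℝ}
    (hWrow : ∀ i, ∑ j, W i j = 1) (A : Fin n → Vec N) (m : Vec N)
    (hm : m = (n : ℝ)⁻¹ • ∑ i, A i) (i : Fin n) :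
    ∑ j, (W - (n : ℝ)⁻¹ • Matrix.of (fun _ _ => (1 : ℝ)) : Matrix (Fin n) (Fin n) ℝ) i j • (A j - m) =
      (∑ j, W i j • A j) - m := by
  have hn' : (n : ℝ) ≠ 0 := by positivity
  have hdev : ∑ j, (A j - m) = 0 := by
    rw [Finset.sum_sub_distrib, Finset.sum_const, Finset.card_univ, Fintype.card_fin, hm,
      ← Nat.cast_smul_eq_nsmul ℝ, smul_inv_smul₀ hn', sub_self]
  simp only [Matrix.sub_apply, Matrix.smul_apply, Matrix.of_apply, smul_eq_mul, mul_one,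
    sub_smul, Finset.sum_sub_distrib, ← Finset.smul_sum, hdev, smul_zero, sub_zero]
  simp only [smul_sub, Finset.sum_sub_distrib, ← Finset.sum_smul, hWrow, one_smul]

theorem statement6
    {n N : ℕ} (hn : 0 < n)
    (f : Fin n → Vec N → ℝ)
    (hdiff : ∀ i, Differentiable ℝ (f i))
    (W : Matrix (Fin n) (Fin n) ℝ)
    (hWnonneg : ∀ i j, 0 ≤ W i j)
    (hWrow : ∀ i, ∑ j, W i j = 1)
    (hWcol : ∀ j, ∑ i, W i j = 1)
    (σ : ℝ)
    (hσ : σ = specNorm (W - (n : ℝ)⁻¹ • Matrix.of (fun _ _ => (1 : ℝ))))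
    (η : ℝ) (hη : 0 < η)
    (x s : ℕ → Fin n → Vec N)
    (hs0 : ∀ i, s 0 i = gradient (f i) (x 0 i))
    (hxupd : ∀ t i, x (t + 1) i = (∑ j, W i j • x t j) - η • s t i)
    (hsupd : ∀ t i, s (t + 1) i =
      (∑ j, W i j • s t j) + gradient (f i) (x (t + 1) i) - gradient (f i) (x t i))
    (xbar g : ℕ → Vec N)
    (hxbar : ∀ t, xbar t = (n : ℝ)⁻¹ • ∑ i, x t i)
    (hg : ∀ t, g t = (n : ℝ)⁻¹ • ∑ i, gradient (f i) (x t i)) :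
    ∀ k : ℕ,
      fro (fun i => x (k + 1) i - xbar (k + 1)) ≤
        σ * fro (fun i => x k i - xbar k) + η * fro (fun i => s k i - g k) := by
  intro k
  have hsum : ∀ t, ∑ i, s t i = ∑ i, gradient (f i) (x t i) := by
    intro t
    induction t with
    | zero => simp only [hs0]
    | succ t ih =>
      simp only [hsupd, Finset.sum_sub_distrib, Finset.sum_add_distrib, sum_sum_smul_eq hWcol, ih]
      abel
  have hmean : xbar (k + 1) = xbar k - η • g k := by
    simp only [hxbar, hg, hxupd, Finset.sum_sub_distrib, sum_sum_smul_eq hWcol,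
      ← Finset.smul_sum, hsum, smul_sub]
    rw [smul_comm]
  have hstep : (fun i => x (k + 1) i - xbar (k + 1)) =
      (fun i => ∑ j, (W - (n : ℝ)⁻¹ • Matrix.of (fun _ _ => (1 : ℝ)) : Matrix (Fin n) (Fin n) ℝ) i j • (x k j - xbar k)) -
        η • (fun i => s k i - g k) := by
    funext i
    rw [Pi.sub_apply, Pi.smul_apply, sum_sub_averaging_smul hn hWrow (x k) _ (hxbar k), hxupd,
      hmean, smul_sub]
    abel
  rw [hstep, hσ]
  refine (fro_sub_le _ _).trans ?_
  rw [fro_smul, abs_of_pos hη]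
  gcongr
  exact fro_mul_le _ _
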